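/- arXiv:2505.09357 — 2 statements merged into one kernel-verified Lean document; each statement's English description precedes it below -/
import Mathlib

section
/- Let n ≥ 2 and s ≥ 2 be integers and let ζ_n = exp(2πi/n). Let M be the s×s complex matrix whose (i,1) entry is (i/(i+1))·C(n−1, i) for 1 ≤ i ≤ s, whose (i,j) entry for 2 ≤ j ≤ i is (1/(i−j+2))·C(n−1, i−j+1), whose (i,i+1) entry is 1, and whose remaining entries (j > i+1) are 0, where C(a,b) denotes the binomial coefficient. Then 𝔷_n(ζ_n; 1, s) = det M. -/
/-- The primitive `n`-th root of unity `ζ_n = exp(2πi/n)`. -/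
noncomputable def zetaN (n : ℕ) : ℂ := Complex.exp (2 * Real.pi * Complex.I / n)

/-- The finite `q`-multiple zeta value `𝔷_n(ζ_n; m, s)`. -/
noncomputable def zmzv (n m s : ℕ) : ℂ :=
  ∑ T ∈ (Finset.Icc 1 (n - 1)).powersetCard m,
    (∏ i ∈ T, (1 - zetaN n ^ i) ^ s)⁻¹

open Finset

/-- Newton's identity, indexed so that the signs sit only on the power sums. -/
theorem MvPolynomial.succ_mul_esymm_succ_eq_sum_range (σ R : Type*) [Fintype σ] [CommRing R]
    (k : ℕ) :
    ((k : MvPolynomial σ R) + 1) * esymm σ R (k + 1) =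
      ∑ l ∈ range (k + 1), esymm σ R (k - l) * ((-1) ^ l * psum σ R (l + 1)) := by
  have h := mul_esymm_eq_sum σ R (k + 1)
  rw [sum_filter, Nat.sum_antidiagonal_eq_sum_range_succ
    (fun a b => if a < k + 1 then (-1) ^ a * esymm σ R a * psum σ R b else 0),
    sum_range_succ, if_neg (lt_irrefl _), add_zero, ← sum_range_reflect] at h
  push_cast at h
  rw [h, mul_sum]
  refine sum_congr rfl fun l hl => ?_
  have hl' : l ≤ k := Nat.lt_succ_iff.mp (mem_range.mp hl)
  obtain ⟨d, rfl⟩ := Nat.exists_eq_add_of_le hl'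
  have h2 : l + d + 1 - d = l + 1 := by omega
  have h3 : l + d - l = d := by omega
  rw [h3, h2, if_pos (by omega)]
  have h4 : (-1 : MvPolynomial σ R) ^ (l + d + 1 + 1) * (-1) ^ d = (-1) ^ l := by
    rw [← pow_add, show l + d + 1 + 1 + d = l + 2 * (d + 1) by ring, pow_add, pow_mul]
    simp
  rw [← h4]
  ring

/-- A matrix whose first column is `x` and whose remaining columns are the first standard basis
vectors has determinant `± x_last`. -/
theorem Matrix.det_cons_standard_basis {R : Type*} [CommRing R] (s : ℕ) (x : Fin (s + 1) → R) :
    (Matrix.of fun i (j : Fin (s + 1)) =>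
      Fin.cases (x i) (fun j' => if i = j'.castSucc then (1 : R) else 0) j).det =
      (-1) ^ s * x (Fin.last s) := by
  rw [Matrix.det_succ_row _ (Fin.last s), Fin.sum_univ_succ, sum_eq_zero, add_zero]
  · have : (Matrix.of fun i (j : Fin (s + 1)) =>
        Fin.cases (motive := fun _ => R) (x i)
          (fun j' => if i = j'.castSucc then (1 : R) else 0) j).submatrix
            (Fin.last s).succAbove (Fin.succAbove 0) = 1 := by
      ext i j
      simp [Matrix.one_apply]
    rw [this]
    simp
  · intro j _
    simp [(Fin.castSucc_lt_last j).ne']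

/-- The determinantal expression of power sums in elementary symmetric polynomials. -/
theorem MvPolynomial.psum_eq_det_esymm (σ R : Type*) [Fintype σ] [CommRing R] (s : ℕ) :
    psum σ R (s + 1) = (Matrix.of fun i j : Fin (s + 1) =>
      if j.1 = 0 then ((i.1 : MvPolynomial σ R) + 1) * esymm σ R (i.1 + 1)
      else if j.1 ≤ i.1 + 1 then esymm σ R (i.1 + 1 - j.1) else 0).det := by
  let L : Matrix (Fin (s + 1)) (Fin (s + 1)) (MvPolynomial σ R) :=
    Matrix.of fun i l => if l ≤ i then esymm σ R (i.1 - l.1) else 0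
  let x : Fin (s + 1) → MvPolynomial σ R := fun l => (-1) ^ l.1 * psum σ R (l.1 + 1)
  have hL : L.det = 1 := by
    rw [Matrix.det_of_isLowerTriangular]
    · simp [L]
    · intro i j hij
      exact if_neg (not_le.mpr hij)
  have hN := Matrix.det_cons_standard_basis s x
  rw [show (-1) ^ s * x (Fin.last s) = psum σ R (s + 1) by
    simp [x, ← mul_assoc, ← pow_add, ← two_mul]] at hN
  rw [← hN, ← one_mul (Matrix.det _)]
  nth_rewrite 1 [← hL]
  rw [← Matrix.det_mul]
  congr 1
  ext1 i j
  rw [Matrix.mul_apply]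
  refine Fin.cases ?_ (fun j => ?_) j
  · simp only [Matrix.of_apply, Fin.cases_zero, Fin.val_zero, if_true, L, x]
    simp only [Fin.le_def]
    rw [succ_mul_esymm_succ_eq_sum_range, Fin.sum_univ_eq_sum_range (fun l =>
      (if l ≤ i.1 then esymm σ R (i.1 - l) else 0) * ((-1) ^ l * psum σ R (l + 1))) (s + 1)]
    symm
    refine sum_subset_zero_on_sdiff (range_mono (by omega)) (fun l hl => ?_) fun l hl => ?_
    · rw [if_neg (by simp only [mem_sdiff, mem_range] at hl; omega), zero_mul]
    · rw [if_pos (Nat.lt_succ_iff.mp (mem_range.mp hl))]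
  · simp only [Matrix.of_apply, Fin.cases_succ, Fin.val_succ, L, mul_ite, mul_one, mul_zero,
      sum_ite_eq', mem_univ, if_true, Fin.le_def, Fin.val_castSucc, Nat.add_one_ne_zero, if_false,
      Nat.add_le_add_iff_right, Nat.add_sub_add_right]

open Polynomial in
theorem IsPrimitiveRoot.prod_X_add_C_one_sub_pow {R : Type*} [CommRing R] [IsDomain R] {n : ℕ}
    {μ : R} (hμ : IsPrimitiveRoot μ (n + 1)) :
    ∏ k : Fin n, (X + C (1 - μ ^ (k.1 + 1))) =
      ∑ i ∈ range (n + 1), ((n + 1).choose (i + 1) : R[X]) * X ^ i := by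
  have h := X_pow_sub_C_eq_prod hμ n.zero_lt_succ (one_pow (n + 1))
  rw [C_1, ← mul_geom_sum, prod_range_succ', pow_zero, mul_one, mul_comm, eq_comm] at h
  replace h := mul_right_cancel₀ (Polynomial.X_sub_C_ne_zero 1) h
  rw [← geom_sum_X_comp_X_add_one_eq_sum, ← h, Polynomial.prod_comp,
    Fin.prod_univ_eq_prod_range (fun k => X + C (1 - μ ^ (k + 1)))]
  refine prod_congr rfl fun k _ => ?_
  simp
  ring

open Polynomial in
theorem Polynomial.coeff_prod_one_add_C_mul_X {ι R : Type*} [CommSemiring R] (s : Finset ι)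
    (f : ι → R) (k : ℕ) :
    (∏ i ∈ s, (1 + C (f i) * X)).coeff k = ∑ t ∈ s.powersetCard k, ∏ i ∈ t, f i := by
  rw [prod_one_add, finsetSum_coeff, powersetCard_eq_filter, sum_filter]
  refine sum_congr rfl fun t _ => ?_
  rw [prod_mul_distrib, prod_const, ← map_prod, coeff_C_mul_X_pow]
  simp [eq_comm]

open Polynomial in
/-- The elementary symmetric functions of the numbers `1 / (1 - μ ^ i)`. -/
theorem IsPrimitiveRoot.sum_powersetCard_prod_inv_one_sub_pow {K : Type*} [Field K] [CharZero K]
    {n : ℕ} {μ : K} (hμ : IsPrimitiveRoot μ (n + 1)) (k : ℕ) :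
    ∑ t ∈ powersetCard k (univ : Finset (Fin n)), ∏ i ∈ t, (1 - μ ^ (i.1 + 1))⁻¹ =
      1 / ((k : K) + 1) * (n.choose k : K) := by
  have hne (i : Fin n) : 1 - μ ^ (i.1 + 1) ≠ 0 :=
    sub_ne_zero.mpr (hμ.pow_ne_one_of_pos_of_lt (by omega) (by omega)).symm
  have hfac : ∏ i : Fin n, (1 + C (1 - μ ^ (i.1 + 1))⁻¹ * X) =
      C ((n : K) + 1)⁻¹ * ∏ i : Fin n, (X + C (1 - μ ^ (i.1 + 1))) := by
    rw [← hμ.prod_one_sub_pow_eq_order,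
      ← Fin.prod_univ_eq_prod_range (fun k => 1 - μ ^ (k + 1)), ← prod_inv_distrib, map_prod,
      ← prod_mul_distrib]
    refine prod_congr rfl fun i _ => ?_
    rw [mul_add, ← C_mul, inv_mul_cancel₀ (hne i), C_1, add_comm]
  rw [← coeff_prod_one_add_C_mul_X, hfac, hμ.prod_X_add_C_one_sub_pow, coeff_C_mul,
    finsetSum_coeff]
  simp only [← C_eq_natCast, coeff_C_mul_X_pow]
  have hk : (k : K) + 1 ≠ 0 := by exact_mod_cast k.succ_ne_zero
  have hn : (n : K) + 1 ≠ 0 := by exact_mod_cast n.succ_ne_zero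
  have hc : ((n : K) + 1) * n.choose k = (n + 1).choose (k + 1) * (k + 1) := by
    exact_mod_cast Nat.add_one_mul_choose_eq n k
  rw [sum_ite_eq, show (if k ∈ range (n + 1) then ((n + 1).choose (k + 1) : K) else 0) =
    (n + 1).choose (k + 1) by
      split_ifs with h
      · rfl
      · rw [Nat.choose_eq_zero_of_lt (by simpa using h), Nat.cast_zero]]
  field_simp
  linear_combination -hc

theorem zmzv_one (n s : ℕ) :
    zmzv (n + 1) 1 s = ∑ i : Fin n, ((1 - zetaN (n + 1) ^ (i.1 + 1))⁻¹) ^ s := by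
  rw [Fin.sum_univ_eq_sum_range (fun i => ((1 - zetaN (n + 1) ^ (i + 1))⁻¹) ^ s),
    range_eq_Ico, sum_Ico_add' (fun i => ((1 - zetaN (n + 1) ^ i)⁻¹) ^ s)]
  simp [zmzv, powersetCard_one, Finset.Ico_add_one_right_eq_Icc]

theorem stmt4 (n s : ℕ) (hn : 2 ≤ n) (hs : 2 ≤ s) :
    zmzv n 1 s =
      Matrix.det (Matrix.of fun i j : Fin s =>
        if j.1 = 0 then (((i.1 : ℂ) + 1) / ((i.1 : ℂ) + 2)) * ((n - 1).choose (i.1 + 1) : ℂ)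
        else if j.1 ≤ i.1 then
          (1 / ((i.1 - j.1 + 2 : ℕ) : ℂ)) * ((n - 1).choose (i.1 - j.1 + 1) : ℂ)
        else if j.1 = i.1 + 1 then 1 else 0) := by
  obtain ⟨n, rfl⟩ : ∃ m, n = m + 1 := ⟨n - 1, by omega⟩
  obtain ⟨s, rfl⟩ : ∃ t, s = t + 1 := ⟨s - 1, by omega⟩
  have hμ : IsPrimitiveRoot (zetaN (n + 1)) (n + 1) :=
    Complex.isPrimitiveRoot_exp _ n.succ_ne_zero
  let f : Fin n → ℂ := fun i => (1 - zetaN (n + 1) ^ (i.1 + 1))⁻¹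
  have he (k : ℕ) : MvPolynomial.aeval f (MvPolynomial.esymm (Fin n) ℂ k) =
      1 / ((k : ℂ) + 1) * (n.choose k : ℂ) := by
    rw [← hμ.sum_powersetCard_prod_inv_one_sub_pow k]
    simp [MvPolynomial.esymm, f]
  have hp := congrArg (MvPolynomial.aeval f) (MvPolynomial.psum_eq_det_esymm (Fin n) ℂ s)
  rw [AlgHom.map_det] at hp
  rw [zmzv_one, show ∑ i : Fin n, ((1 - zetaN (n + 1) ^ (i.1 + 1))⁻¹) ^ (s + 1) =
    MvPolynomial.aeval f (MvPolynomial.psum (Fin n) ℂ (s + 1)) by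
      simp [MvPolynomial.psum, f], hp]
  congr 1
  ext1 i j
  simp only [AlgHom.mapMatrix_apply, Matrix.map_apply, Matrix.of_apply,
    apply_ite (MvPolynomial.aeval f), map_mul, map_add, map_natCast, map_one, map_zero, he, Nat.add_sub_cancel]
  split_ifs with _ _ _ h
  all_goals try omega
  · push_cast
    ring
  · rw [show i.1 + 1 - j.1 = i.1 - j.1 + 1 by omega]
    push_cast
    ring
  · simp [h]
  · rfl
end

section
/- Let n ≥ 2 and m ≥ 1 be integers and let ζ_n = exp(2πi/n). Then 𝔷_n(ζ_n; m, 3) = (1/(n^2(m+1)))·( C(n−1, m) + C(n−1, 3m+2) ) − (1/n^2)·∑_{k=0}^{⌊(m+1)/2⌋} ∑_{i=0}^{m−2k+1} (1/(m−k+1))·C(m−k+1, k)·C(m−2k+1, i)·C(n+m−2k−i, 3m−3k+2)·2^i·(−3)^{m−2k−i+1}, where C(a,b) denotes the binomial coefficient. -/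
open PowerSeries in
/-- The geometric series with ratio `r` is inverse to `1 - r X`. -/
theorem one_sub_C_mul_X_mul_mk_pow {R : Type*} [CommRing R] (r : R) :
    (1 - C r * X) * (mk fun n => r ^ n) = (1 : R⟦X⟧) := by
  ext n
  cases n with
  | zero => simp [sub_mul]
  | succ n => simp [sub_mul, mul_assoc, pow_succ']

open PowerSeries in
/-- The derivative of the truncated series of `-log (1 + f)`. -/
theorem one_add_mul_derivative_log_trunc {K R : Type*} [Field K] [CharZero K] [CommRing R]
    [Algebra K R] (f : R⟦X⟧) (N : ℕ) :
    (1 + f) * d⁄dX R (∑ j ∈ Finset.range N,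
      C (algebraMap K R ((j + 1 : ℕ) : K)⁻¹) * (-f) ^ (j + 1)) =
      -d⁄dX R f * (1 - (-f) ^ N) := by
  have h : d⁄dX R (∑ j ∈ Finset.range N,
      C (algebraMap K R ((j + 1 : ℕ) : K)⁻¹) * (-f) ^ (j + 1)) =
      (∑ j ∈ Finset.range N, (-f) ^ j) * -d⁄dX R f := by
    rw [map_sum, Finset.sum_mul]
    refine Finset.sum_congr rfl fun j _ => ?_
    have hj : (C (algebraMap K R ((j + 1 : ℕ) : K)⁻¹) : R⟦X⟧) * ((j + 1 : ℕ) : R⟦X⟧) = 1 := by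
      rw [← map_natCast (C (R := R)), ← map_natCast (algebraMap K R), ← map_mul, ← map_mul,
        inv_mul_cancel₀ (Nat.cast_ne_zero.2 j.succ_ne_zero), map_one, map_one]
    rw [Derivation.leibniz, derivative_C, derivative_pow, map_neg, smul_zero, add_zero, smul_eq_mul,
      Nat.add_sub_cancel]
    linear_combination (-f) ^ j * -d⁄dX R f * hj
  have hg := geom_sum_mul (-f) N
  rw [h]
  linear_combination d⁄dX R f * hg

open PowerSeries in
/-- Power sums of the three roots of a cubic with `e₁ = 3`, `e₂ = 3 (1 + T)` and
`e₃ = (1 + T) ^ 2`, as coefficients of a truncated logarithm. -/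
theorem power_sum_eq_coeff_log {K R : Type*} [Field K] [CharZero K] [CommRing R]
    [Algebra K R] (a b c T : R) (h₁ : a + b + c = 3) (h₂ : a * b + b * c + c * a = 3 * (1 + T))
    (h₃ : a * b * c = (1 + T) ^ 2) {n N : ℕ} (hn : n < N) :
    a ^ (n + 1) + b ^ (n + 1) + c ^ (n + 1) = 3 + coeff (n + 1) (∑ j ∈ Finset.range N,
      C (algebraMap K R ((j + 1 : ℕ) : K)⁻¹) *
        (-((C T * (3 * X ^ 2 - 2 * X ^ 3) - C (T ^ 2) * X ^ 3) * mk 1 ^ 3)) ^ (j + 1)) *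
      (n + 1) := by
  set u : R⟦X⟧ := mk 1 with hu
  set f : R⟦X⟧ := (C T * (3 * X ^ 2 - 2 * X ^ 3) - C (T ^ 2) * X ^ 3) * u ^ 3 with hf
  rw [← coeff_derivative]
  have hL := one_add_mul_derivative_log_trunc (K := K) f N
  set L := d⁄dX R (∑ j ∈ Finset.range N,
      C (algebraMap K R ((j + 1 : ℕ) : K)⁻¹) * (-f) ^ (j + 1))
  have hu1 : u * (1 - X) = 1 := mk_one_mul_one_sub_eq_one R
  have ha := one_sub_C_mul_X_mul_mk_pow a
  have hb := one_sub_C_mul_X_mul_mk_pow b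
  have hc := one_sub_C_mul_X_mul_mk_pow c
  set ga : R⟦X⟧ := mk fun n => a ^ n with hga
  set gb : R⟦X⟧ := mk fun n => b ^ n with hgb
  set gc : R⟦X⟧ := mk fun n => c ^ n with hgc
  have e₁ : (C a + C b + C c : R⟦X⟧) = 3 := by rw [← map_add, ← map_add, h₁]; exact map_ofNat C 3
  have e₂ : (C a * C b + C b * C c + C c * C a : R⟦X⟧) = 3 * (1 + C T) := by
    rw [← map_mul, ← map_mul, ← map_mul, ← map_add, ← map_add, h₂, map_mul, map_add,
      map_one, map_ofNat]
  have e₃ : (C a * C b * C c : R⟦X⟧) = (1 + C T) ^ 2 := by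
    rw [← map_mul, ← map_mul, h₃]; simp
  -- the cubic, factored in two ways
  have hD : ((1 - C a * X) * (1 - C b * X) * (1 - C c * X) : R⟦X⟧) = (1 - X) ^ 3 * (1 + f) := by
    have hu3 : u ^ 3 * (1 - X) ^ 3 = 1 := by rw [← mul_pow, hu1, one_pow]
    rw [hf, map_pow]
    linear_combination -X * e₁ + X ^ 2 * e₂ - X ^ 3 * e₃ -
      (C T * (3 * X ^ 2 - 2 * X ^ 3) - C T ^ 2 * X ^ 3) * hu3
  have hD' := congrArg (d⁄dX R) hD
  simp only [Derivation.leibniz, map_sub, map_add, derivative_C, derivative_X, derivative_pow,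
    derivative_one, smul_eq_mul] at hD'
  push_cast at hD'
  have hP : (1 + f) * (C a * ga + C b * gb + C c * gc - 3 * u) = -d⁄dX R f := by
    have hDP : ((1 - C a * X) * (1 - C b * X) * (1 - C c * X)) *
        (C a * ga + C b * gb + C c * gc) = C a * (1 - C b * X) * (1 - C c * X) +
        C b * (1 - C a * X) * (1 - C c * X) + C c * (1 - C a * X) * (1 - C b * X) := by
      linear_combination C a * (1 - C b * X) * (1 - C c * X) * ha +
        C b * (1 - C a * X) * (1 - C c * X) * hb + C c * (1 - C a * X) * (1 - C b * X) * hc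
    have hmul : (1 - X) ^ 3 * ((1 + f) * (C a * ga + C b * gb + C c * gc - 3 * u)) =
        (1 - X) ^ 3 * -d⁄dX R f := by
      linear_combination hDP - hD' - (C a * ga + C b * gb + C c * gc) * hD -
        3 * (1 - X) ^ 2 * (1 + f) * hu1
    have hunit : IsUnit ((1 - X : R⟦X⟧) ^ 3) :=
      (IsUnit.of_mul_eq_one u (by rw [mul_comm, hu1])).pow 3
    exact hunit.mul_left_cancel hmul
  have hQ : X ^ N ∣ C a * ga + C b * gb + C c * gc - 3 * u - L := by
    have hX : X ∣ f := ⟨(C T * (3 * X - 2 * X ^ 2) - C (T ^ 2) * X ^ 2) * u ^ 3, by rw [hf]; ring⟩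
    have hunit : IsUnit (1 + f) := by
      rw [isUnit_iff_constantCoeff, map_add, X_dvd_iff.1 hX, map_one, add_zero]
      exact isUnit_one
    rw [← hunit.dvd_mul_left]
    have : (1 + f) * (C a * ga + C b * gb + C c * gc - 3 * u - L) = -d⁄dX R f * (-f) ^ N := by
      linear_combination hP - hL
    rw [this]
    exact Dvd.dvd.mul_left (pow_dvd_pow_of_dvd ((dvd_neg).2 hX) N) _
  have h0 := X_pow_dvd_iff.1 hQ n hn
  have h3 : (3 : R⟦X⟧) = C 3 := (map_ofNat C 3).symm
  rw [h3] at h0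
  simp only [map_sub, map_add, coeff_C_mul, hga, hgb, hgc, hu, coeff_mk, Pi.one_apply] at h0
  linear_combination h0

open PowerSeries in
/-- The coefficients of the powers of the rational function
`(T (2 X³ - 3 X²) + T² X³) / (1 - X)³`. -/
theorem coeff_neg_pow_eq_sum {R : Type*} [CommRing R] (T : R) (n j : ℕ) :
    coeff (n + 1)
      ((-((C T * (3 * X ^ 2 - 2 * X ^ 3) - C (T ^ 2) * X ^ 3) * mk 1 ^ 3)) ^ (j + 1)) =
    ∑ k ∈ Finset.range (j + 1 + 1), ∑ i ∈ Finset.range (j + 1 - k + 1),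
      T ^ (j + 1 + k) * (((j + 1).choose k : R) * ((j + 1 - k).choose i : R) *
        ((n + (j + 1 - k) - i).choose (3 * j + 2) : R) * 2 ^ i * (-3) ^ (j + 1 - k - i)) := by
  have hexp : (-((C T * (3 * X ^ 2 - 2 * X ^ 3) - C (T ^ 2) * X ^ 3) * mk 1 ^ 3)) ^ (j + 1) =
      ∑ k ∈ Finset.range (j + 1 + 1), ∑ i ∈ Finset.range (j + 1 - k + 1),
        C (T ^ (j + 1 + k) * (((j + 1).choose k : R) * ((j + 1 - k).choose i : R) *
          2 ^ i * (-3) ^ (j + 1 - k - i))) *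
          (X ^ (2 * (j + 1) + k + i) * (mk 1 : R⟦X⟧) ^ (3 * j + 2 + 1)) := by
    have hneg : (-((C T * (3 * X ^ 2 - 2 * X ^ 3) - C (T ^ 2) * X ^ 3) * mk 1 ^ 3) : R⟦X⟧) =
        (C T ^ 2 * X ^ 3 + C T * X ^ 2 * (2 * X + -3)) * mk 1 ^ 3 := by
      rw [map_pow]; ring
    rw [hneg, mul_pow, add_pow, Finset.sum_mul]
    refine Finset.sum_congr rfl fun k hk => ?_
    have hk' : k ≤ j + 1 := by simpa [Nat.lt_succ_iff] using hk
    obtain ⟨l, hl⟩ := Nat.exists_eq_add_of_le hk'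
    have hl' : j + 1 - k = l := by omega
    rw [hl', mul_pow _ (2 * X + -3), add_pow, Finset.mul_sum, Finset.mul_sum, Finset.sum_mul,
      Finset.sum_mul]
    refine Finset.sum_congr rfl fun i _ => ?_
    have h3 : 3 * j + 2 + 1 = 3 * (k + l) := by omega
    rw [h3, hl]
    simp only [map_mul, map_pow, map_natCast, map_neg, map_ofNat]
    ring
  rw [hexp, map_sum]
  refine Finset.sum_congr rfl fun k hk => ?_
  rw [map_sum]
  refine Finset.sum_congr rfl fun i hi => ?_
  simp only [Finset.mem_range] at hk hi
  rw [coeff_C_mul, coeff_X_pow_mul', mk_one_pow_eq_mk_choose_add, coeff_mk]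
  split_ifs with h
  · have h' : 3 * j + 2 + (n + 1 - (2 * (j + 1) + k + i)) = n + (j + 1 - k) - i := by omega
    rw [h']
    ring
  · rw [Nat.choose_eq_zero_of_lt (show n + (j + 1 - k) - i < 3 * j + 2 by omega)]
    simp

open Polynomial in
/-- Power sums of the three roots of a cubic with coefficients in `ℂ[X ^ 3]`. -/
theorem coeff_power_sum_eq_sum (a b c : ℂ[X]) (h₁ : a + b + c = 3)
    (h₂ : a * b + b * c + c * a = 3 * (1 + X ^ 3)) (h₃ : a * b * c = (1 + X ^ 3) ^ 2) (n m : ℕ) :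
    (a ^ (n + 1) + b ^ (n + 1) + c ^ (n + 1)).coeff (3 * (m + 1)) = (n + 1) *
      ∑ k ∈ Finset.range ((m + 1) / 2 + 1),
        ∑ i ∈ Finset.range (m + 1 - 2 * k + 1),
          (1 / ((m - k + 1 : ℕ) : ℂ)) * ((m - k + 1).choose k : ℂ) *
            ((m + 1 - 2 * k).choose i : ℂ) *
            ((n + 1 + m - 2 * k - i).choose (3 * m - 3 * k + 2) : ℂ) *
            2 ^ i * (-3 : ℂ) ^ (m + 1 - 2 * k - i) := by
  rw [power_sum_eq_coeff_log (K := ℂ) a b c (X ^ 3) h₁ h₂ h₃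
    (show n < n + 1 + m by omega), map_sum]
  simp only [PowerSeries.coeff_C_mul, coeff_neg_pow_eq_sum]
  have h3 : (3 : ℂ[X]).coeff (3 * (m + 1)) = 0 := by
    rw [← map_ofNat C 3, coeff_C, if_neg (by omega)]
  have hn : ((n : ℂ[X]) + 1) = C ((n : ℂ) + 1) := by simp
  rw [coeff_add, h3, zero_add, hn, coeff_mul_C, mul_comm, finsetSum_coeff]
  congr 1
  have hterm : ∀ j k i : ℕ, (X ^ 3) ^ (j + 1 + k) * (((j + 1).choose k : ℂ[X]) *
      ((j + 1 - k).choose i : ℂ[X]) * ((n + (j + 1 - k) - i).choose (3 * j + 2) : ℂ[X]) *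
      2 ^ i * (-3) ^ (j + 1 - k - i)) = C (((j + 1).choose k : ℂ) *
      ((j + 1 - k).choose i : ℂ) * ((n + (j + 1 - k) - i).choose (3 * j + 2) : ℂ) *
      2 ^ i * (-3) ^ (j + 1 - k - i)) * X ^ (3 * (j + 1 + k)) := fun j k i => by
    simp only [map_mul, map_pow, map_natCast, map_neg, map_ofNat, ← pow_mul]
    ring
  simp only [hterm, algebraMap_eq, coeff_C_mul, finsetSum_coeff, coeff_X_pow,
    Nat.mul_left_cancel_iff (show 0 < 3 by norm_num), mul_ite, mul_one, mul_zero]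
  simp only [Finset.mul_sum, Finset.sum_sigma', mul_ite, mul_zero]
  rw [← Finset.sum_filter]
  refine Finset.sum_nbij' (fun p => p.2) (fun p => ⟨m - p.1, p⟩) ?_ ?_ ?_ ?_ ?_
  · rintro ⟨j, k, i⟩ h
    simp only [Finset.mem_filter, Finset.mem_sigma, Finset.mem_range] at h ⊢
    omega
  · rintro ⟨k, i⟩ h
    simp only [Finset.mem_filter, Finset.mem_sigma, Finset.mem_range] at h ⊢
    omega
  · rintro ⟨j, k, i⟩ h
    simp only [Finset.mem_filter, Finset.mem_sigma, Finset.mem_range] at h ⊢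
    have : m - k = j := by omega
    subst this
    rfl
  · rintro ⟨k, i⟩ _
    rfl
  · rintro ⟨j, k, i⟩ h
    simp only [Finset.mem_filter, Finset.mem_sigma, Finset.mem_range] at h ⊢
    have hj : m - k = j := by omega
    have hk : m + 1 - 2 * k = j + 1 - k := by omega
    have hc : n + 1 + m - 2 * k - i = n + (j + 1 - k) - i := by omega
    have hd : 3 * m - 3 * k + 2 = 3 * j + 2 := by omega
    rw [hj, hk, hc, hd]
    ring

open Polynomial in
/-- Evaluating `X ^ n - 1 = ∏ (X - ζ ^ i)` at `1 + p`, with the factor `i = 0` split off. -/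
theorem IsPrimitiveRoot.one_add_pow_sub_one_eq_prod {ζ : ℂ} {n : ℕ} (hζ : IsPrimitiveRoot ζ n)
    (hn : 0 < n) (p : ℂ[X]) :
    (1 + p) ^ n - 1 = p * ∏ i ∈ Finset.Icc 1 (n - 1), (C (1 - ζ ^ i) + p) := by
  have h := congrArg (fun q : ℂ[X] => q.comp (1 + p)) (X_pow_sub_C_eq_prod hζ hn (one_pow n))
  have hr : Finset.range n = insert 0 (Finset.Icc 1 (n - 1)) := by
    ext i
    simp only [Finset.mem_range, Finset.mem_insert, Finset.mem_Icc]
    omega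
  simp only [sub_comp, pow_comp, X_comp, C_comp, prod_comp, mul_one] at h
  rw [map_one C] at h
  rw [h, hr, Finset.prod_insert (by simp), pow_zero, map_one, add_sub_cancel_left]
  congr 1
  refine Finset.prod_congr rfl fun i _ => ?_
  rw [map_sub, map_one]
  ring

open Polynomial in
/-- `∏ (1 - ζ ^ i) = n` for a primitive `n`-th root of unity `ζ`. -/
theorem IsPrimitiveRoot.prod_one_sub_pow_eq_natCast {ζ : ℂ} {n : ℕ} (hζ : IsPrimitiveRoot ζ n)
    (hn : 0 < n) : ∏ i ∈ Finset.Icc 1 (n - 1), (1 - ζ ^ i) = n := by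
  have h := congrArg (fun q : ℂ[X] => q.coeff 1) (hζ.one_add_pow_sub_one_eq_prod hn X)
  rw [show 1 = 0 + 1 from rfl, coeff_X_mul, coeff_zero_eq_eval_zero, eval_prod, zero_add,
    coeff_sub, coeff_one_add_X_pow, coeff_one] at h
  simpa using h.symm

open Polynomial in
/-- The normalized form of `IsPrimitiveRoot.one_add_pow_sub_one_eq_prod`. -/
theorem IsPrimitiveRoot.one_add_pow_sub_one_eq_mul_prod {ζ : ℂ} {n : ℕ}
    (hζ : IsPrimitiveRoot ζ n) (hn : 0 < n) (p : ℂ[X]) :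
    (1 + p) ^ n - 1 = n * p * ∏ i ∈ Finset.Icc 1 (n - 1), (1 + C (1 - ζ ^ i)⁻¹ * p) := by
  rw [hζ.one_add_pow_sub_one_eq_prod hn, ← map_natCast (C (R := ℂ)),
    ← hζ.prod_one_sub_pow_eq_natCast hn, map_prod, mul_comm _ p, mul_assoc,
    ← Finset.prod_mul_distrib]
  congr 1
  refine Finset.prod_congr rfl fun i hi => ?_
  have hne : 1 - ζ ^ i ≠ 0 := by
    rw [Finset.mem_Icc] at hi
    exact sub_ne_zero.2 (hζ.pow_ne_one_of_pos_of_lt (by omega) (by omega)).symm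
  rw [mul_add, mul_one, ← mul_assoc, ← map_mul, mul_inv_cancel₀ hne, map_one, one_mul]

open Polynomial in
/-- Elementary symmetric sums as coefficients of a product in `X ^ 3`. -/
theorem coeff_prod_one_add_C_mul_X_cube (s : Finset ℕ) (x : ℕ → ℂ) (m : ℕ) :
    (∏ i ∈ s, (1 + C (x i) * X ^ 3)).coeff (3 * m) = ∑ t ∈ s.powersetCard m, ∏ i ∈ t, x i := by
  rw [Finset.prod_one_add, finsetSum_coeff]
  have h : ∀ t : Finset ℕ, (∏ i ∈ t, (C (x i) * X ^ 3)).coeff (3 * m) =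
      if t.card = m then ∏ i ∈ t, x i else 0 := fun t => by
    rw [Finset.prod_mul_distrib, ← map_prod, Finset.prod_const, ← pow_mul, coeff_C_mul,
      coeff_X_pow, mul_ite, mul_one, mul_zero]
    exact if_congr (by omega) rfl rfl
  simp only [h]
  rw [← Finset.sum_filter, Finset.powersetCard_eq_filter]

open Polynomial in
/-- The coefficient of `X ^ (3 M)` in `(1 + w X) ^ n` for a cube root of unity `w`. -/
theorem coeff_one_add_C_mul_X_pow_of_cube_eq_one {w : ℂ} (hw : w ^ 3 = 1) (n M : ℕ) :
    ((1 + C w * X) ^ n).coeff (3 * M) = (n.choose (3 * M) : ℂ) := by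
  have h : (1 + C w * X) ^ n = ((1 + X) ^ n).comp (C w * X) := by simp
  rw [h, comp_C_mul_X_coeff, coeff_one_add_X_pow, pow_mul, hw, one_pow, mul_one]

theorem zetaN_isPrimitiveRoot {n : ℕ} (hn : n ≠ 0) : IsPrimitiveRoot (zetaN n) n :=
  Complex.isPrimitiveRoot_exp n hn

open Polynomial in
/-- The generating function of `zmzv n m 3`, for a primitive cube root of unity `ω`. -/
theorem cube_mul_zmzv_eq_coeff {n : ℕ} (hn : 0 < n) {ω : ℂ} (hω : 1 + ω + ω ^ 2 = 0) (m : ℕ) :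
    (n : ℂ) ^ 3 * zmzv n m 3 = (((1 + X) ^ n - 1) * ((1 + C ω * X) ^ n - 1) *
      ((1 + C (ω ^ 2) * X) ^ n - 1) : ℂ[X]).coeff (3 * (m + 1)) := by
  have hζ := zetaN_isPrimitiveRoot hn.ne'
  have hC : (1 + C ω + C ω ^ 2 : ℂ[X]) = 0 := by
    rw [← map_one C, ← map_pow, ← map_add, ← map_add, hω, map_zero]
  have hC3 : (C ω ^ 3 : ℂ[X]) = 1 := by linear_combination (C ω - 1) * hC
  have hprod : (((1 + X) ^ n - 1) * ((1 + C ω * X) ^ n - 1) *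
      ((1 + C (ω ^ 2) * X) ^ n - 1) : ℂ[X]) = C ((n : ℂ) ^ 3) *
      ((∏ i ∈ Finset.Icc 1 (n - 1), (1 + C (((1 - zetaN n ^ i) ^ 3)⁻¹) * X ^ 3)) * X ^ 3) := by
    have hfac : ∏ i ∈ Finset.Icc 1 (n - 1), (1 + C (((1 - zetaN n ^ i) ^ 3)⁻¹) * X ^ 3) =
        (∏ i ∈ Finset.Icc 1 (n - 1), (1 + C (1 - zetaN n ^ i)⁻¹ * X)) *
        (∏ i ∈ Finset.Icc 1 (n - 1), (1 + C (1 - zetaN n ^ i)⁻¹ * (C ω * X))) *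
        ∏ i ∈ Finset.Icc 1 (n - 1), (1 + C (1 - zetaN n ^ i)⁻¹ * (C (ω ^ 2) * X)) := by
      rw [← Finset.prod_mul_distrib, ← Finset.prod_mul_distrib]
      refine Finset.prod_congr rfl fun i _ => ?_
      rw [← inv_pow, map_pow, map_pow]
      set x : ℂ[X] := C (1 - zetaN n ^ i)⁻¹
      linear_combination (-x * X - C ω * x ^ 2 * X ^ 2) * hC - x ^ 3 * X ^ 3 * hC3
    rw [hζ.one_add_pow_sub_one_eq_mul_prod hn, hζ.one_add_pow_sub_one_eq_mul_prod hn,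
      hζ.one_add_pow_sub_one_eq_mul_prod hn, hfac]
    simp only [map_pow, map_natCast]
    linear_combination (n : ℂ[X]) ^ 3 * X ^ 3 *
      ((∏ i ∈ Finset.Icc 1 (n - 1), (1 + C (1 - zetaN n ^ i)⁻¹ * X)) *
        (∏ i ∈ Finset.Icc 1 (n - 1), (1 + C (1 - zetaN n ^ i)⁻¹ * (C ω * X))) *
        ∏ i ∈ Finset.Icc 1 (n - 1), (1 + C (1 - zetaN n ^ i)⁻¹ * (C ω ^ 2 * X))) * hC3
  rw [hprod, coeff_C_mul, show 3 * (m + 1) = 3 * m + 3 by ring, coeff_mul_X_pow,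
    coeff_prod_one_add_C_mul_X_cube, zmzv]
  simp only [Finset.prod_inv_distrib]

open Polynomial in
theorem stmt12 (n m : ℕ) (hn : 2 ≤ n) (hm : 1 ≤ m) :
    zmzv n m 3 =
      (1 / ((n : ℂ) ^ 2 * ((m : ℂ) + 1))) *
        (((n - 1).choose m : ℂ) + ((n - 1).choose (3 * m + 2) : ℂ)) -
      (1 / (n : ℂ) ^ 2) *
        ∑ k ∈ Finset.range ((m + 1) / 2 + 1),
          ∑ i ∈ Finset.range (m + 1 - 2 * k + 1),
            (1 / ((m - k + 1 : ℕ) : ℂ)) * ((m - k + 1).choose k : ℂ) *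
              ((m + 1 - 2 * k).choose i : ℂ) *
              ((n + m - 2 * k - i).choose (3 * m - 3 * k + 2) : ℂ) *
              2 ^ i * (-3 : ℂ) ^ (m + 1 - 2 * k - i) := by
  obtain ⟨n, rfl⟩ : ∃ l, n = l + 1 := ⟨n - 1, by omega⟩
  obtain ⟨ω, hω⟩ : ∃ ω : ℂ, 1 + ω + ω ^ 2 = 0 := by
    have h := (Complex.isPrimitiveRoot_exp 3 (by norm_num)).geom_sum_eq_zero (by norm_num)
    exact ⟨_, by simpa [Finset.sum_range_succ] using h⟩
  have hω3 : ω ^ 3 = 1 := by linear_combination (ω - 1) * hω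
  have hC : (1 + C ω + C ω ^ 2 : ℂ[X]) = 0 := by
    rw [← map_one C, ← map_pow, ← map_add, ← map_add, hω, map_zero]
  have hC3 : (C ω ^ 3 : ℂ[X]) = 1 := by rw [← map_pow, hω3, map_one]
  set A : ℂ[X] := 1 + X with hA
  set B : ℂ[X] := 1 + C ω * X with hB
  set D : ℂ[X] := 1 + C (ω ^ 2) * X with hD
  rw [map_pow] at hD
  have s₁ : A + B + D = 3 := by
    rw [hA, hB, hD]
    linear_combination X * hC
  have s₂ : A * B + B * D + D * A = 3 := by
    rw [hA, hB, hD]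
    linear_combination (2 * X + C ω * X ^ 2) * hC
  have s₃ : A * B * D = 1 + X ^ 3 := by
    rw [hA, hB, hD]
    linear_combination (X + C ω * X ^ 2) * hC + X ^ 3 * hC3
  have hS := coeff_power_sum_eq_sum (A * B) (B * D) (D * A) s₂
    (by linear_combination A * B * D * s₁ + 3 * s₃)
    (by linear_combination (A * B * D + (1 + X ^ 3)) * s₃) n m
  set S := ∑ k ∈ Finset.range ((m + 1) / 2 + 1), ∑ i ∈ Finset.range (m + 1 - 2 * k + 1),
    (1 / ((m - k + 1 : ℕ) : ℂ)) * ((m - k + 1).choose k : ℂ) *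
      ((m + 1 - 2 * k).choose i : ℂ) *
      ((n + 1 + m - 2 * k - i).choose (3 * m - 3 * k + 2) : ℂ) *
      2 ^ i * (-3 : ℂ) ^ (m + 1 - 2 * k - i)
  have hz := cube_mul_zmzv_eq_coeff (n := n + 1) n.succ_pos hω m
  have hexp : (A ^ (n + 1) - 1) * (B ^ (n + 1) - 1) * (D ^ (n + 1) - 1) =
      (1 + X ^ 3) ^ (n + 1) + (A ^ (n + 1) + B ^ (n + 1) + D ^ (n + 1)) -
        ((A * B) ^ (n + 1) + (B * D) ^ (n + 1) + (D * A) ^ (n + 1)) - 1 := by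
    rw [← s₃]
    simp only [mul_pow]
    ring
  have hcube : ((1 + X ^ 3 : ℂ[X]) ^ (n + 1)).coeff (3 * (m + 1)) = (n + 1).choose (m + 1) := by
    have : (1 + X ^ 3 : ℂ[X]) ^ (n + 1) = expand ℂ 3 ((1 + X) ^ (n + 1)) := by simp
    rw [this, coeff_expand_mul' (by norm_num), coeff_one_add_X_pow]
  have hone : (1 : ℂ[X]).coeff (3 * (m + 1)) = 0 := by
    rw [coeff_one, if_neg (by omega)]
  have hcA : (A ^ (n + 1)).coeff (3 * (m + 1)) = (n + 1).choose (3 * (m + 1)) :=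
    coeff_one_add_X_pow ℂ _ _
  have hcB : (B ^ (n + 1)).coeff (3 * (m + 1)) = (n + 1).choose (3 * (m + 1)) :=
    coeff_one_add_C_mul_X_pow_of_cube_eq_one hω3 _ _
  have hcD : (D ^ (n + 1)).coeff (3 * (m + 1)) = (n + 1).choose (3 * (m + 1)) := by
    rw [hD, ← map_pow]
    exact coeff_one_add_C_mul_X_pow_of_cube_eq_one
      (by rw [← pow_mul, mul_comm, pow_mul, hω3, one_pow]) _ _
  rw [hexp, coeff_sub, coeff_sub, hS, coeff_add, coeff_add, coeff_add, hcube, hone, hcA, hcB,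
    hcD] at hz
  have hch₁ : ((n : ℂ) + 1) * (n.choose m : ℂ) = ((n + 1).choose (m + 1) : ℂ) * (m + 1) := by
    exact_mod_cast Nat.add_one_mul_choose_eq n m
  have hch₂ : ((n : ℂ) + 1) * (n.choose (3 * m + 2) : ℂ) =
      ((n + 1).choose (3 * (m + 1)) : ℂ) * (3 * (m + 1)) := by
    exact_mod_cast Nat.add_one_mul_choose_eq n (3 * m + 2)
  have hn0 : (n : ℂ) + 1 ≠ 0 := Nat.cast_add_one_ne_zero n
  have hm0 : (m : ℂ) + 1 ≠ 0 := Nat.cast_add_one_ne_zero m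
  rw [Nat.add_sub_cancel]
  push_cast at hz ⊢
  field_simp
  refine mul_left_cancel₀ hn0 ?_
  linear_combination (m + 1 : ℂ) * hz - hch₁ - hch₂
end
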